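/- Let Ω ⊂ ℝ^d be a bounded, uniform domain, 0 < s < 1, 1 ≤ p < ∞ and 0 ≤ α, β < codim̲_A(∂Ω). For n ∈ ℕ let v_n(x) = max{min{2 − n d_Ω(x), 1}, 0}. Then there exists a constant C = C(d,s,p,α,β,Ω) > 0 such that for all f ∈ W^{s,p;α,β}(Ω) and all n ∈ ℕ: [f v_n]^p_{W^{s,p;α,β}(Ω)} ≤ C n^{sp} ∫_{Ω_{3/n}} |f(x)|^p d_Ω(x)^{−α−β} dx + C ∫_{Ω_{3/n}} ∫_{Ω_{3/n}} |f(x)−f(y)|^p |x−y|^{−d−sp} d_Ω(x)^{−α} d_Ω(y)^{−β} dy dx, where Ω_r = {x ∈ Ω : d_Ω(x) ≤ r}. -/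

import Mathlib

open MeasureTheory Metric Set Filter
open scoped ENNReal NNReal

noncomputable section

/-- Euclidean space `ℝ^d`. -/
abbrev Rd (d : ℕ) := EuclideanSpace ℝ (Fin d)

/-- `d_Ω(x)`: the distance from `x` to the boundary `∂Ω`. -/
def distBd {d : ℕ} (Ω : Set (Rd d)) (x : Rd d) : ℝ := Metric.infDist x (frontier Ω)

/-- The `p`-th power of the weighted Gagliardo seminorm `[f]_{W^{s,p;α,β}(Ω)}^p`, with
power-of-distance-to-the-boundary weights `d_Ω(y)^{-β} d_Ω(x)^{-α}`. -/
def gagP {d : ℕ} (Ω : Set (Rd d)) (s p α β : ℝ) (f : Rd d → ℝ) : ℝ≥0∞ :=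
  ∫⁻ x in Ω, ∫⁻ y in Ω, ENNReal.ofReal
    (|f x - f y| ^ p / dist x y ^ ((d : ℝ) + s * p)
      * distBd Ω y ^ (-β) * distBd Ω x ^ (-α))

/-- The weighted Gagliardo seminorm `[f]_{W^{s,p;α,β}(Ω)}`. -/
def gagSemi {d : ℕ} (Ω : Set (Rd d)) (s p α β : ℝ) (f : Rd d → ℝ) : ℝ≥0∞ :=
  gagP Ω s p α β f ^ (1 / p)

/-- Membership in the weighted fractional Sobolev space `W^{s,p;α,β}(Ω)`. -/
def memW {d : ℕ} (Ω : Set (Rd d)) (s p α β : ℝ) (f : Rd d → ℝ) : Prop :=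
  MemLp f (ENNReal.ofReal p) (volume.restrict Ω) ∧ gagP Ω s p α β f < ⊤

/-- The norm `‖f‖_{L^p(Ω)} + [f]_{W^{s,p;α,β}(Ω)}` (as an extended real). -/
def wNorm {d : ℕ} (Ω : Set (Rd d)) (s p α β : ℝ) (f : Rd d → ℝ) : ℝ≥0∞ :=
  eLpNorm f (ENNReal.ofReal p) (volume.restrict Ω) + gagSemi Ω s p α β f

/-- Membership in `W_0^{s,p;α,β}(Ω)`: the closure of `C_c^∞(Ω) ∩ W^{s,p;α,β}(Ω)` in
`W^{s,p;α,β}(Ω)`. -/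
def memW0 {d : ℕ} (Ω : Set (Rd d)) (s p α β : ℝ) (f : Rd d → ℝ) : Prop :=
  memW Ω s p α β f ∧ ∀ ε : ℝ, 0 < ε → ∃ φ : Rd d → ℝ,
    ContDiff ℝ (⊤ : ℕ∞) φ ∧ HasCompactSupport φ ∧ tsupport φ ⊆ Ω ∧ memW Ω s p α β φ ∧
    wNorm Ω s p α β (fun x => f x - φ x) < ENNReal.ofReal ε

/-- The defining set for the lower Assouad codimension: admissible exponents `q`. -/
def lowerCodimSet {d : ℕ} (E : Set (Rd d)) : Set ℝ :=
  {q : ℝ | 0 ≤ q ∧ ∃ C : ℝ, 1 ≤ C ∧ ∀ x ∈ E, ∀ r R : ℝ, 0 < r → r < R →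
    ENNReal.ofReal R < EMetric.diam E →
    volume (Metric.cthickening r E ∩ Metric.ball x R)
      ≤ ENNReal.ofReal (C * (r / R) ^ q) * volume (Metric.ball x R)}

/-- The lower Assouad codimension. -/
def lowerCodimA {d : ℕ} (E : Set (Rd d)) : ℝ := sSup (lowerCodimSet E)

/-- The upper Assouad codimension. -/
def upperCodimA {d : ℕ} (E : Set (Rd d)) : ℝ :=
  sInf {q : ℝ | 0 ≤ q ∧ ∃ c : ℝ, 0 < c ∧ ∀ x ∈ E, ∀ r R : ℝ, 0 < r → r < R →
    ENNReal.ofReal R < EMetric.diam E →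
    ENNReal.ofReal (c * (r / R) ^ q) * volume (Metric.ball x R)
      ≤ volume (Metric.cthickening r E ∩ Metric.ball x R)}

/-- The upper Minkowski dimension. -/
def upperMinkDim {d : ℕ} (E : Set (Rd d)) : ℝ :=
  sInf {t : ℝ | 0 ≤ t ∧
    Filter.limsup (fun r : ℝ =>
        volume (Metric.cthickening r E) * ENNReal.ofReal (r ^ (t - (d : ℝ))))
      (nhdsWithin 0 (Set.Ioi 0)) = 0}

/-- Uniform domain: any two points are joined by a `1`-Lipschitz (arc-length parameterized)
curve of length `≤ C|x-y|` staying quantitatively away from the boundary. -/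
def IsUniformDomain {d : ℕ} (Ω : Set (Rd d)) : Prop :=
  ∃ C : ℝ, 1 ≤ C ∧ ∀ x ∈ Ω, ∀ y ∈ Ω, ∃ (l : ℝ) (γ : ℝ → Rd d),
    0 ≤ l ∧ l ≤ C * dist x y ∧ γ 0 = x ∧ γ l = y ∧
    (∀ t ∈ Set.Icc 0 l, γ t ∈ Ω) ∧
    LipschitzOnWith 1 γ (Set.Icc 0 l) ∧
    ∀ t ∈ Set.Icc 0 l,
      min (dist (γ t) x) (dist (γ t) y) / C ≤ Metric.infDist (γ t) (frontier Ω)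

/-- `κ`-plumpness. -/
def IsPlump {d : ℕ} (κ : ℝ) (E : Set (Rd d)) : Prop :=
  ∀ r : ℝ, 0 < r → ENNReal.ofReal r < EMetric.diam E →
    ∀ x ∈ closure E, ∃ z ∈ Metric.closedBall x r, Metric.ball z (κ * r) ⊆ E

/-- `σ`-homogeneity: `|V(E,x,λ,r)| ≤ L r^d λ^σ` where
`V(E,x,λ,r) = {y : dist(y,E) ≤ r, |x-y| ≤ λ r}`. -/
def IsHomog {d : ℕ} (σ : ℝ) (E : Set (Rd d)) : Prop :=
  ∃ L : ℝ, 0 < L ∧ ∀ x ∈ E, ∀ lam r : ℝ, 1 ≤ lam → 0 < r →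
    volume (Metric.cthickening r E ∩ Metric.closedBall x (lam * r))
      ≤ ENNReal.ofReal (L * r ^ (d : ℝ) * lam ^ σ)

/-- The axis-parallel cube with corner `a` and side length `l`. -/
def cube {d : ℕ} (a : Rd d) (l : ℝ) : Set (Rd d) :=
  {y | ∀ i, y i ∈ Set.Icc (a i) (a i + l)}

/-- Muckenhoupt `A₁` class: `|Q|⁻¹ ∫_Q w ≤ A inf_Q w` for all cubes `Q`. -/
def IsA1 {d : ℕ} (w : Rd d → ℝ) : Prop :=
  (∀ x, 0 < w x) ∧ ∃ A : ℝ, 0 < A ∧ ∀ (a : Rd d) (l : ℝ), 0 < l →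
    ∫⁻ x in cube a l, ENNReal.ofReal (w x)
      ≤ ENNReal.ofReal (A * l ^ (d : ℝ)) * ⨅ y ∈ cube a l, ENNReal.ofReal (w y)

/-- The `p`-th power of the Gagliardo seminorm with general weights `w(x) v(y)`. -/
def gagPW {d : ℕ} (Ω : Set (Rd d)) (s p : ℝ) (w v f : Rd d → ℝ) : ℝ≥0∞ :=
  ∫⁻ x in Ω, ∫⁻ y in Ω, ENNReal.ofReal
    (|f x - f y| ^ p / dist x y ^ ((d : ℝ) + s * p) * w x * v y)

/-- Membership in `W^{s,p;w,v}(Ω)` for general weights. -/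
def memWgen {d : ℕ} (Ω : Set (Rd d)) (s p : ℝ) (w v f : Rd d → ℝ) : Prop :=
  MemLp f (ENNReal.ofReal p) (volume.restrict Ω) ∧ gagPW Ω s p w v f < ⊤

/-- The norm of `W^{s,p;w,v}(Ω)` (as an extended real). -/
def wNormGen {d : ℕ} (Ω : Set (Rd d)) (s p : ℝ) (w v f : Rd d → ℝ) : ℝ≥0∞ :=
  eLpNorm f (ENNReal.ofReal p) (volume.restrict Ω) + gagPW Ω s p w v f ^ (1 / p)

/-- Membership in `W_0^{s,p;w,v}(Ω)`. -/
def memW0gen {d : ℕ} (Ω : Set (Rd d)) (s p : ℝ) (w v f : Rd d → ℝ) : Prop :=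
  memWgen Ω s p w v f ∧ ∀ ε : ℝ, 0 < ε → ∃ φ : Rd d → ℝ,
    ContDiff ℝ (⊤ : ℕ∞) φ ∧ HasCompactSupport φ ∧ tsupport φ ⊆ Ω ∧ memWgen Ω s p w v φ ∧
    wNormGen Ω s p w v (fun x => f x - φ x) < ENNReal.ofReal ε

/-- Membership in `W_c^{s,p;w,v}(Ω)`: the closure of compactly supported measurable
functions. -/
def memWcgen {d : ℕ} (Ω : Set (Rd d)) (s p : ℝ) (w v f : Rd d → ℝ) : Prop :=
  memWgen Ω s p w v f ∧ ∀ ε : ℝ, 0 < ε → ∃ g : Rd d → ℝ,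
    Measurable g ∧ HasCompactSupport g ∧ tsupport g ⊆ Ω ∧ memWgen Ω s p w v g ∧
    wNormGen Ω s p w v (fun x => f x - g x) < ENNReal.ofReal ε

end

/-- The coefficients of the dyadic decomposition of a truncated kernel are summable. -/
lemma summable_dyadic_kernel {s p : ℝ} (hs0 : 0 < s) (hs1 : s < 1) (hp : 1 ≤ p) :
    Summable fun k : ℤ => (min 1 ((2 : ℝ) ^ ((k : ℝ) + 1))) ^ p * (2 : ℝ) ^ (-((k : ℝ) * (s * p))) := by
  have hsp : 0 < s * p := by positivity
  have hsp' : 0 < p * (1 - s) := mul_pos (by linarith) (by linarith)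
  have hgeo : ∀ a : ℝ, 0 < a → Summable fun k : ℕ => ((2 : ℝ) ^ (-a)) ^ k := fun a ha =>
    summable_geometric_of_lt_one (by positivity)
      (Real.rpow_lt_one_of_one_lt_of_neg (by norm_num) (by linarith))
  apply Summable.of_nat_of_neg
  · refine Summable.of_nonneg_of_le (fun k => by positivity) (fun k => ?_) (hgeo _ hsp)
    have h1 : (min 1 ((2 : ℝ) ^ ((k : ℝ) + 1))) ^ p ≤ 1 :=
      Real.rpow_le_one (by positivity) (min_le_left _ _) (by linarith)
    rw [← Real.rpow_natCast, ← Real.rpow_mul (by norm_num)]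
    push_cast
    calc _ ≤ 1 * (2 : ℝ) ^ (-((k : ℝ) * (s * p))) := by gcongr
      _ = _ := by rw [one_mul]; congr 1; ring
  · refine Summable.of_nonneg_of_le (fun k => by positivity) (fun k => ?_)
      ((hgeo _ hsp').mul_left ((2 : ℝ) ^ p))
    push_cast
    calc _ ≤ ((2 : ℝ) ^ (-(k : ℝ) + 1)) ^ p * (2 : ℝ) ^ (-(-(k : ℝ) * (s * p))) := by
            gcongr
            exact min_le_right _ _
      _ = _ := by
          rw [← Real.rpow_natCast, ← Real.rpow_mul (by norm_num), ← Real.rpow_mul (by norm_num),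
            ← Real.rpow_add (by norm_num), ← Real.rpow_add (by norm_num)]
          congr 1; ring

/-- If the balls centred at `x` have `μ`-measure at most `K R ^ D`, then the truncated kernel
of order `s` is `μ`-integrable with the scaling-invariant bound. -/
lemma exists_lintegral_truncated_kernel_le (X : Type*) [PseudoMetricSpace X] [MeasurableSpace X]
    [OpensMeasurableSpace X] {D s p : ℝ} (hD : 0 ≤ D) (hs0 : 0 < s) (hs1 : s < 1)
    (hp : 1 ≤ p) :
    ∃ C : ℝ, 0 < C ∧ ∀ (μ : Measure X) (x : X) (K : ℝ), 0 ≤ K →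
      (∀ R : ℝ, 0 < R → μ (ball x R) ≤ ENNReal.ofReal (K * R ^ D)) → ∀ n : ℝ, 0 < n →
      ∫⁻ y, ENNReal.ofReal ((min 1 (n * dist x y)) ^ p / dist x y ^ (D + s * p)) ∂μ
        ≤ ENNReal.ofReal (C * n ^ (s * p) * K) := by
  set a : ℤ → ℝ := fun k =>
    (min 1 ((2 : ℝ) ^ ((k : ℝ) + 1))) ^ p * (2 : ℝ) ^ (-((k : ℝ) * (s * p))) with ha
  have hsum : Summable a := summable_dyadic_kernel hs0 hs1 hp
  have ha0 : ∀ k, 0 < a k := fun k => by positivity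
  refine ⟨2 ^ D * ∑' k, a k, mul_pos (by positivity) (hsum.tsum_pos (fun k => (ha0 k).le) 0 (ha0 0)),
    fun μ x K hK hμ n hn => ?_⟩
  set c : ℤ → ℝ := fun k =>
    (min 1 ((2 : ℝ) ^ ((k : ℝ) + 1))) ^ p * ((2 : ℝ) ^ (k : ℝ) / n) ^ (-(D + s * p)) with hc
  have hc0 : ∀ k, 0 ≤ c k := fun k => by positivity
  have hpt : ∀ y, ENNReal.ofReal ((min 1 (n * dist x y)) ^ p / dist x y ^ (D + s * p)) ≤
      ∑' k : ℤ, (ball x ((2 : ℝ) ^ ((k : ℝ) + 1) / n)).indicator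
        (fun _ => ENNReal.ofReal (c k)) y := by
    intro y
    rcases (dist_nonneg (x := x) (y := y)).eq_or_lt with h0 | hpos
    · rw [← h0]
      simp [Real.zero_rpow (by linarith : p ≠ 0)]
    · obtain ⟨k, hk1, hk2⟩ := exists_mem_Ico_zpow (x := n * dist x y) (y := (2 : ℝ))
        (by positivity) (by norm_num)
      rw [← Real.rpow_intCast] at hk1 hk2
      push_cast at hk2
      refine le_trans ?_ (ENNReal.le_tsum k)
      rw [indicator_of_mem]
      · apply ENNReal.ofReal_le_ofReal
        rw [div_eq_mul_inv, ← Real.rpow_neg hpos.le]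
        have hkd : (2 : ℝ) ^ (k : ℝ) / n ≤ dist x y := by rw [div_le_iff₀ hn]; linarith
        have hsp : 0 ≤ s * p := by positivity
        have hexp := Real.rpow_le_rpow_of_nonpos (z := -(D + s * p)) (by positivity) hkd
          (by linarith)
        simp only [hc]
        gcongr
      · rw [mem_ball, dist_comm, lt_div_iff₀ hn]; linarith
  calc _ ≤ ∫⁻ y, ∑' k : ℤ, (ball x ((2 : ℝ) ^ ((k : ℝ) + 1) / n)).indicator
        (fun _ => ENNReal.ofReal (c k)) y ∂μ := lintegral_mono hpt
    _ = ∑' k : ℤ, ENNReal.ofReal (c k) * μ (ball x ((2 : ℝ) ^ ((k : ℝ) + 1) / n)) := by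
        rw [lintegral_tsum fun k => (measurable_const.indicator measurableSet_ball).aemeasurable]
        simp_rw [lintegral_indicator_const measurableSet_ball]
    _ ≤ ∑' k : ℤ, ENNReal.ofReal (2 ^ D * n ^ (s * p) * K * a k) := by
        refine ENNReal.tsum_le_tsum fun k => ?_
        refine (mul_le_mul_right (hμ _ (by positivity)) _).trans ?_
        rw [← ENNReal.ofReal_mul (hc0 k)]
        apply ENNReal.ofReal_le_ofReal (le_of_eq _)
        simp only [hc, ha]
        rw [Real.div_rpow (by positivity) hn.le, Real.div_rpow (by positivity) hn.le,
          ← Real.rpow_mul (by norm_num), ← Real.rpow_mul (by norm_num), Real.rpow_neg hn.le,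
          Real.rpow_add hn, show (k : ℝ) * -(D + s * p) = -((k : ℝ) * (s * p)) + -((k : ℝ) * D) by ring,
          show ((k : ℝ) + 1) * D = k * D + D by ring, Real.rpow_add (by norm_num : (0 : ℝ) < 2) (-_),
          Real.rpow_add (by norm_num : (0 : ℝ) < 2) (k * D), Real.rpow_neg (by norm_num) (k * D)]
        field_simp
    _ = _ := by
        rw [← ENNReal.ofReal_tsum_of_nonneg (fun k => by have := (ha0 k).le; positivity)
          (hsum.mul_left _), tsum_mul_left]
        congr 1; ring

/-- A set of positive lower Assouad codimension has positive diameter. -/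
lemma ediam_pos_of_lowerCodimA_pos {d : ℕ} {E : Set (Rd d)} (h : 0 < lowerCodimA E) :
    0 < Metric.ediam E := by
  by_contra h0
  have hset : lowerCodimSet E = Ici 0 := by
    ext q
    refine ⟨fun hq => hq.1, fun hq => ⟨hq, 1, le_rfl, fun x _ r R _ _ hR => ?_⟩⟩
    exact absurd ((zero_le).trans_lt hR) h0
  rw [lowerCodimA, hset, Real.sSup_of_not_bddAbove (not_bddAbove_Ici 0)] at h
  exact lt_irrefl _ h

/-- The volume of a Euclidean ball as a real multiple of the power of the radius. -/
lemma volume_ball_eq_ofReal {d : ℕ} (x : Rd d) {R : ℝ} (hR : 0 < R) :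
    volume (ball x R) =
      ENNReal.ofReal ((volume (ball (0 : Rd d) 1)).toReal * R ^ (d : ℝ)) := by
  rw [Measure.addHaar_ball_of_pos volume x hR, finrank_euclideanSpace_fin,
    ENNReal.ofReal_mul ENNReal.toReal_nonneg, ENNReal.ofReal_toReal measure_ball_lt_top.ne,
    Real.rpow_natCast, mul_comm]

/-- Negative powers of the distance to `E` of exponent less than an admissible codimension
exponent are integrable over balls centred on `E`, with the natural scaling. -/
lemma exists_setLIntegral_ball_infDist_rpow_le {d : ℕ} {E Ω : Set (Rd d)} (hΩ : MeasurableSet Ω)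
    (hpos : ∀ y ∈ Ω, 0 < infDist y E) {q β : ℝ} (hq : q ∈ lowerCodimSet E) (hβ0 : 0 ≤ β)
    (hβ : β < q) :
    ∃ K : ℝ, 0 < K ∧ ∀ w ∈ E, ∀ R : ℝ, 0 < R → ENNReal.ofReal R < Metric.ediam E →
      ∫⁻ y in ball w R ∩ Ω, ENNReal.ofReal (infDist y E ^ (-β))
        ≤ ENNReal.ofReal (K * R ^ ((d : ℝ) - β)) := by
  obtain ⟨hq0, C, hC, hvol⟩ := hq
  set V := (volume (ball (0 : Rd d) 1)).toReal
  have hV : 0 < V := ENNReal.toReal_pos (measure_ball_pos _ _ one_pos).ne' measure_ball_lt_top.ne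
  set θ : ℝ := (1 / 2 : ℝ) ^ (q - β) with hθ
  have hθ0 : 0 < θ := by positivity
  have hθ1 : θ < 1 := Real.rpow_lt_one (by norm_num) (by norm_num) (by linarith)
  have hsum := summable_geometric_of_lt_one hθ0.le hθ1
  have hC0 : 0 < C := by linarith
  refine ⟨C * V * 2 ^ β * ∑' k : ℕ, θ ^ k, mul_pos (by positivity)
    (hsum.tsum_pos (fun k => by positivity) 0 (by positivity)), fun w hw R hR hRE => ?_⟩
  set c : ℕ → ℝ := fun k => (R * (1 / 2 : ℝ) ^ (k + 1)) ^ (-β) with hc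
  have hmeas : ∀ k : ℕ, MeasurableSet (cthickening (R * (1 / 2 : ℝ) ^ k) E ∩ ball w R) :=
    fun k => isClosed_cthickening.measurableSet.inter measurableSet_ball
  have hpt : ∀ y ∈ ball w R ∩ Ω, ENNReal.ofReal (infDist y E ^ (-β)) ≤
      ∑' k : ℕ, (cthickening (R * (1 / 2 : ℝ) ^ k) E ∩ ball w R).indicator
        (fun _ => ENNReal.ofReal (c k)) y := by
    rintro y ⟨hy, hyΩ⟩
    have hδ := hpos y hyΩ
    have hδR : infDist y E < R := (infDist_le_dist_of_mem hw).trans_lt hy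
    obtain ⟨k, hk1, hk2⟩ := exists_nat_pow_near_of_lt_one (x := infDist y E / R) (y := (1 / 2 : ℝ))
      (by positivity) ((div_le_one hR).2 hδR.le) (by norm_num) (by norm_num)
    rw [lt_div_iff₀ hR] at hk1
    rw [div_le_iff₀ hR] at hk2
    refine le_trans ?_ (ENNReal.le_tsum k)
    rw [indicator_of_mem]
    · exact ENNReal.ofReal_le_ofReal (Real.rpow_le_rpow_of_nonpos (by positivity)
        (by linarith) (by linarith))
    · refine ⟨?_, hy⟩
      have hne : E.Nonempty := ⟨w, hw⟩
      rw [mem_cthickening_iff, ENNReal.le_ofReal_iff_toReal_le (infEDist_ne_top hne) (by positivity)]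
      exact hk2.trans_eq (mul_comm _ _)
  have hvol' : ∀ k : ℕ, volume (cthickening (R * (1 / 2 : ℝ) ^ k) E ∩ ball w R) ≤
      ENNReal.ofReal (C * ((1 / 2 : ℝ) ^ k) ^ q * (V * R ^ (d : ℝ))) := by
    intro k
    rw [ENNReal.ofReal_mul (by positivity), ← volume_ball_eq_ofReal w hR]
    rcases k.eq_zero_or_pos with rfl | hk
    · refine (measure_mono inter_subset_right).trans ?_
      simpa using mul_le_mul_left (ENNReal.one_le_ofReal.2 hC) (volume (ball w R))
    · have h1 : (1 / 2 : ℝ) ^ k < 1 := pow_lt_one₀ (by norm_num) (by norm_num) hk.ne'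
      have := hvol w hw (R * (1 / 2 : ℝ) ^ k) R (by positivity) (by nlinarith) hRE
      rwa [mul_div_cancel_left₀ _ hR.ne'] at this
  calc _ ≤ ∫⁻ y in ball w R ∩ Ω, ∑' k : ℕ,
        (cthickening (R * (1 / 2 : ℝ) ^ k) E ∩ ball w R).indicator
          (fun _ => ENNReal.ofReal (c k)) y :=
        setLIntegral_mono' (measurableSet_ball.inter hΩ) hpt
    _ ≤ ∫⁻ y, ∑' k : ℕ, (cthickening (R * (1 / 2 : ℝ) ^ k) E ∩ ball w R).indicator
          (fun _ => ENNReal.ofReal (c k)) y := setLIntegral_le_lintegral _ _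
    _ = ∑' k : ℕ, ENNReal.ofReal (c k) *
          volume (cthickening (R * (1 / 2 : ℝ) ^ k) E ∩ ball w R) := by
        rw [lintegral_tsum fun k => (measurable_const.indicator (hmeas k)).aemeasurable]
        simp_rw [lintegral_indicator_const (hmeas _)]
    _ ≤ ∑' k : ℕ, ENNReal.ofReal (C * V * 2 ^ β * R ^ ((d : ℝ) - β) * θ ^ k) := by
        refine ENNReal.tsum_le_tsum fun k => ?_
        refine (mul_le_mul_right (hvol' k) _).trans ?_
        rw [← ENNReal.ofReal_mul (by positivity)]
        apply ENNReal.ofReal_le_ofReal (le_of_eq _)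
        have h2 : (1 / 2 : ℝ) ^ (-β) = 2 ^ β := by
          rw [one_div, Real.inv_rpow (by norm_num), Real.rpow_neg (by norm_num), inv_inv]
        have h3 : ((1 / 2 : ℝ) ^ k) ^ (-β) * ((1 / 2 : ℝ) ^ k) ^ q = θ ^ k := by
          rw [← Real.rpow_add (by positivity), hθ, ← Real.rpow_natCast, ← Real.rpow_natCast,
            ← Real.rpow_mul (by norm_num), ← Real.rpow_mul (by norm_num)]
          congr 1; ring
        simp only [hc]
        rw [Real.mul_rpow hR.le (by positivity), pow_succ, Real.mul_rpow (by positivity) (by norm_num),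
          h2, ← h3, sub_eq_add_neg, Real.rpow_add hR]
        ring
    _ = _ := by
        rw [← ENNReal.ofReal_tsum_of_nonneg (fun k => by positivity) (hsum.mul_left _),
          tsum_mul_left]
        congr 1; ring

/-- Global integrability of negative powers of the distance to a compact set. -/
lemma setLIntegral_infDist_rpow_lt_top {d : ℕ} {E Ω : Set (Rd d)} (hΩ : MeasurableSet Ω)
    (hbdd : Bornology.IsBounded Ω) (hE : IsCompact E) (hdiam : 0 < Metric.ediam E)
    (hpos : ∀ y ∈ Ω, 0 < infDist y E) {q β : ℝ} (hq : q ∈ lowerCodimSet E) (hβ0 : 0 ≤ β)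
    (hβ : β < q) :
    ∫⁻ y in Ω, ENNReal.ofReal (infDist y E ^ (-β)) < ⊤ := by
  obtain ⟨K, hK, hball⟩ := exists_setLIntegral_ball_infDist_rpow_le hΩ hpos hq hβ0 hβ
  have hne : E.Nonempty := by
    rw [nonempty_iff_ne_empty]
    rintro rfl
    simp at hdiam
  obtain ⟨R, hR0, hR⟩ := ENNReal.lt_iff_exists_real_btwn.1 hdiam |>.imp fun R h => h.2
  have hRpos : 0 < R := ENNReal.ofReal_pos.1 hR0
  obtain ⟨t, htE, htfin, hcov⟩ := hE.finite_cover_balls (half_pos hRpos)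
  have hsub : Ω ⊆ (Ω ∩ {y | R / 2 ≤ infDist y E}) ∪ ⋃ w ∈ t, (ball w R ∩ Ω) := by
    intro y hy
    by_cases h : R / 2 ≤ infDist y E
    · exact Or.inl ⟨hy, h⟩
    · right
      obtain ⟨e, he, hye⟩ := (infDist_lt_iff hne).1 (not_le.1 h)
      obtain ⟨w, hw, hew⟩ := mem_iUnion₂.1 (hcov he)
      refine mem_iUnion₂.2 ⟨w, hw, ?_, hy⟩
      have := dist_triangle y e w
      rw [mem_ball] at hew ⊢
      linarith
  refine (lintegral_mono_set hsub).trans_lt ((lintegral_union_le _ _ _).trans_lt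
    (ENNReal.add_lt_top.2 ⟨?_, ?_⟩))
  · have hle : ∀ y ∈ Ω ∩ {y | R / 2 ≤ infDist y E},
        ENNReal.ofReal (infDist y E ^ (-β)) ≤ ENNReal.ofReal ((R / 2) ^ (-β)) := fun y hy =>
      ENNReal.ofReal_le_ofReal (Real.rpow_le_rpow_of_nonpos (by positivity) hy.2 (by linarith))
    refine (setLIntegral_mono measurable_const hle).trans_lt ?_
    rw [setLIntegral_const]
    exact ENNReal.mul_lt_top ENNReal.ofReal_lt_top
      ((hbdd.subset inter_subset_left).measure_lt_top)
  · have := htfin.countable.to_subtype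
    have := htfin.fintype
    rw [biUnion_eq_iUnion]
    refine (lintegral_iUnion_le _ _).trans_lt ?_
    rw [tsum_fintype]
    exact ENNReal.sum_lt_top.2 fun w _ =>
      (hball w (htE w.2) R hRpos hR).trans_lt ENNReal.ofReal_lt_top

/-- The `A₁`-type estimate: averages of `dist(·, E) ^ (-β)` over balls centred at `x` are
controlled by the value at `x`. -/
lemma exists_setLIntegral_ball_infDist_rpow_le_center {d : ℕ} {E Ω : Set (Rd d)}
    (hΩ : MeasurableSet Ω) (hbdd : Bornology.IsBounded Ω) (hE : IsCompact E)
    (hdiam : 0 < Metric.ediam E)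
    (hpos : ∀ y ∈ Ω, 0 < infDist y E) {q β : ℝ} (hq : q ∈ lowerCodimSet E) (hβ0 : 0 ≤ β)
    (hβ : β < q) :
    ∃ K : ℝ, 0 < K ∧ ∀ x ∈ Ω, ∀ R : ℝ, 0 < R →
      ∫⁻ y in ball x R ∩ Ω, ENNReal.ofReal (infDist y E ^ (-β))
        ≤ ENNReal.ofReal (K * infDist x E ^ (-β) * R ^ (d : ℝ)) := by
  obtain ⟨K, hK, hball⟩ := exists_setLIntegral_ball_infDist_rpow_le hΩ hpos hq hβ0 hβ
  have htop := setLIntegral_infDist_rpow_lt_top hΩ hbdd hE hdiam hpos hq hβ0 hβ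
  set M := (∫⁻ y in Ω, ENNReal.ofReal (infDist y E ^ (-β))).toReal with hM
  have hM0 : 0 ≤ M := ENNReal.toReal_nonneg
  have hne : E.Nonempty := by
    rw [nonempty_iff_ne_empty]
    rintro rfl
    simp at hdiam
  set V := (volume (ball (0 : Rd d) 1)).toReal
  have hV : 0 ≤ V := ENNReal.toReal_nonneg
  have hD0 : 0 < Metric.diam E := ENNReal.toReal_pos hdiam.ne' hE.isBounded.ediam_ne_top
  obtain ⟨w₀, hw₀⟩ := hne
  obtain ⟨B, hBpos, hB⟩ := hbdd.subset_ball_lt 0 w₀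
  have hBx : ∀ x ∈ Ω, infDist x E ≤ B := fun x hx =>
    (infDist_le_dist_of_mem hw₀).trans (hB hx).le
  refine ⟨2 ^ β * V + K * 3 ^ (d : ℝ) + M * (3 / Metric.diam E) ^ (d : ℝ) * B ^ β,
    by positivity, fun x hx R hR => ?_⟩
  have hδ := hpos x hx
  set δ := infDist x E
  by_cases hsmall : R ≤ δ / 2
  · have hle : ∀ y ∈ ball x R ∩ Ω,
        ENNReal.ofReal (infDist y E ^ (-β)) ≤ ENNReal.ofReal ((δ / 2) ^ (-β)) := by
      rintro y ⟨hy, -⟩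
      refine ENNReal.ofReal_le_ofReal (Real.rpow_le_rpow_of_nonpos (by positivity) ?_ (by linarith))
      have := infDist_le_infDist_add_dist (s := E) (x := x) (y := y)
      rw [mem_ball, dist_comm] at hy
      linarith
    refine (setLIntegral_mono measurable_const hle).trans ?_
    rw [setLIntegral_const]
    refine (mul_le_mul_right (measure_mono inter_subset_left) _).trans ?_
    rw [volume_ball_eq_ofReal x hR, ← ENNReal.ofReal_mul (by positivity)]
    apply ENNReal.ofReal_le_ofReal
    rw [Real.div_rpow hδ.le (by norm_num), Real.rpow_neg (by norm_num : (0 : ℝ) ≤ 2), div_inv_eq_mul]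
    have : 0 ≤ (K * 3 ^ (d : ℝ) + M * (3 / Metric.diam E) ^ (d : ℝ) * B ^ β) *
      δ ^ (-β) * R ^ (d : ℝ) := by positivity
    linarith
  push Not at hsmall
  by_cases hlarge : ENNReal.ofReal (3 * R) < Metric.ediam E
  · obtain ⟨w, hw, hxw⟩ := hE.exists_infDist_eq_dist ⟨w₀, hw₀⟩ x
    have hsub : ball x R ∩ Ω ⊆ ball w (3 * R) ∩ Ω := by
      refine inter_subset_inter_left _ (ball_subset_ball' ?_)
      rw [← hxw]
      linarith
    refine (lintegral_mono_set hsub).trans ((hball w hw (3 * R) (by positivity) hlarge).trans ?_)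
    apply ENNReal.ofReal_le_ofReal
    rw [sub_eq_add_neg, Real.rpow_add (by positivity), Real.mul_rpow (by norm_num) hR.le]
    have h1 : (3 * R) ^ (-β) ≤ δ ^ (-β) :=
      Real.rpow_le_rpow_of_nonpos hδ (by linarith) (by linarith)
    calc K * (3 ^ (d : ℝ) * R ^ (d : ℝ) * (3 * R) ^ (-β))
        ≤ K * (3 ^ (d : ℝ) * R ^ (d : ℝ) * δ ^ (-β)) := by gcongr
      _ ≤ _ := by
        have : 0 ≤ (2 ^ β * V + M * (3 / Metric.diam E) ^ (d : ℝ) * B ^ β) *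
          δ ^ (-β) * R ^ (d : ℝ) := by positivity
        linarith
  · have hDR : Metric.diam E ≤ 3 * R := by
      by_contra h
      exact hlarge ((ENNReal.ofReal_lt_iff_lt_toReal (by positivity)
        hE.isBounded.ediam_ne_top).2 (not_le.1 h))
    refine (lintegral_mono_set inter_subset_right).trans ?_
    rw [← ENNReal.ofReal_toReal htop.ne]
    apply ENNReal.ofReal_le_ofReal
    have h1 : 1 ≤ (3 / Metric.diam E) ^ (d : ℝ) * R ^ (d : ℝ) := by
      rw [← Real.mul_rpow (by positivity) hR.le]
      apply Real.one_le_rpow _ (by positivity)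
      rw [div_mul_eq_mul_div, one_le_div hD0]
      exact hDR
    have h2 : 1 ≤ B ^ β * δ ^ (-β) := by
      rw [Real.rpow_neg hδ.le, ← div_eq_mul_inv, one_le_div (by positivity)]
      exact Real.rpow_le_rpow hδ.le (hBx x hx) hβ0
    calc M ≤ M * (((3 / Metric.diam E) ^ (d : ℝ) * R ^ (d : ℝ)) * (B ^ β * δ ^ (-β))) :=
          le_mul_of_one_le_right hM0 (one_le_mul_of_one_le_of_one_le h1 h2)
      _ ≤ _ := by
        have : 0 ≤ (2 ^ β * V + K * 3 ^ (d : ℝ)) * δ ^ (-β) * R ^ (d : ℝ) := by positivity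
        linarith

/-- The weighted truncated kernel estimate: integrating the truncated kernel of order `s` against
`dist(·, E) ^ (-β)` costs `n ^ (s p)` times the weight at the centre. -/
lemma exists_setLIntegral_truncated_kernel_weight_le {d : ℕ} {E Ω : Set (Rd d)}
    (hΩ : MeasurableSet Ω) (hbdd : Bornology.IsBounded Ω) (hE : IsCompact E)
    (hdiam : 0 < Metric.ediam E)
    (hpos : ∀ y ∈ Ω, 0 < infDist y E) {q s p β : ℝ} (hq : q ∈ lowerCodimSet E)
    (hs0 : 0 < s) (hs1 : s < 1) (hp : 1 ≤ p) (hβ0 : 0 ≤ β) (hβ : β < q) :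
    ∃ C : ℝ, 0 < C ∧ ∀ x ∈ Ω, ∀ n : ℝ, 0 < n →
      ∫⁻ y in Ω, ENNReal.ofReal
          ((min 1 (n * dist x y)) ^ p / dist x y ^ ((d : ℝ) + s * p) * infDist y E ^ (-β))
        ≤ ENNReal.ofReal (C * n ^ (s * p) * infDist x E ^ (-β)) := by
  obtain ⟨K, hK, hA⟩ :=
    exists_setLIntegral_ball_infDist_rpow_le_center hΩ hbdd hE hdiam hpos hq hβ0 hβ
  obtain ⟨C, hC, hker⟩ := exists_lintegral_truncated_kernel_le (Rd d)
    (Nat.cast_nonneg d : (0 : ℝ) ≤ d) hs0 hs1 hp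
  refine ⟨C * K, by positivity, fun x hx n hn => ?_⟩
  have hw : Measurable fun y => ENNReal.ofReal (infDist y E ^ (-β)) := by fun_prop
  have hk : Measurable fun y => ENNReal.ofReal
      ((min 1 (n * dist x y)) ^ p / dist x y ^ ((d : ℝ) + s * p)) := by fun_prop
  have hδ := hpos x hx
  have key := hker ((volume.restrict Ω).withDensity fun y => ENNReal.ofReal (infDist y E ^ (-β)))
    x (K * infDist x E ^ (-β)) (by positivity) (fun R hR => by
      rw [withDensity_apply _ measurableSet_ball, Measure.restrict_restrict measurableSet_ball]
      exact hA x hx R hR) n hn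
  rw [lintegral_withDensity_eq_lintegral_mul _ hw hk] at key
  refine le_trans (le_of_eq (lintegral_congr fun y => ?_)) (key.trans_eq ?_)
  · rw [Pi.mul_apply, mul_comm, ENNReal.ofReal_mul (Real.rpow_nonneg infDist_nonneg _)]
  · congr 1; ring

/-- Convexity bound for powers of a sum. -/
lemma add_rpow_le_two_rpow_mul {a b p : ℝ} (ha : 0 ≤ a) (hb : 0 ≤ b) (hp : 1 ≤ p) :
    (a + b) ^ p ≤ 2 ^ (p - 1) * (a ^ p + b ^ p) := by
  lift a to ℝ≥0 using ha
  lift b to ℝ≥0 using hb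
  exact_mod_cast NNReal.rpow_add_le_mul_rpow_add_rpow a b hp

/-- Pointwise bound for the increments of a truncated function in terms of the increments of the
function and a truncated kernel. The set `{δ ≤ 3 / n}` contains the `1 / n`-neighbourhood of the
set where the cut-off is nonzero. -/
lemma abs_cutoff_sub_rpow_le {X : Type*} [PseudoMetricSpace X] {δ f : X → ℝ}
    (hδ : LipschitzWith 1 δ) {p n : ℝ} (hp : 1 ≤ p) (hn : 0 < n) (x y : X) :
    |f x * max (min (2 - n * δ x) 1) 0 - f y * max (min (2 - n * δ y) 1) 0| ^ p ≤
      2 ^ (p - 1) * (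
        {z : X × X | δ z.1 ≤ 3 / n ∧ δ z.2 ≤ 3 / n}.indicator (fun z => |f z.1 - f z.2| ^ p) (x, y)
        + {z | δ z ≤ 3 / n}.indicator (fun z => |f z| ^ p) x * (min 1 (n * dist x y)) ^ p
        + {z | δ z ≤ 3 / n}.indicator (fun z => |f z| ^ p) y * (min 1 (n * dist x y)) ^ p) := by
  have hp0 : 0 < p := by linarith
  set v : X → ℝ := fun x => max (min (2 - n * δ x) 1) 0 with hv
  have hv0 : ∀ x, 0 ≤ v x := fun x => le_max_right _ _
  have hv1 : ∀ x, v x ≤ 1 := fun x => max_le (min_le_right _ _) zero_le_one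
  have hdist : ∀ x y, |δ x - δ y| ≤ dist x y := fun x y => by
    simpa [Real.dist_eq] using hδ.dist_le_mul x y
  have hvL : |v x - v y| ≤ min 1 (n * dist x y) := by
    refine le_min (abs_le.2 ⟨by linarith [hv0 x, hv1 y], by linarith [hv0 y, hv1 x]⟩) ?_
    calc |v x - v y| ≤ |min (2 - n * δ x) 1 - min (2 - n * δ y) 1| := by
          simpa using abs_max_sub_max_le_max (min (2 - n * δ x) 1) 0 (min (2 - n * δ y) 1) 0
      _ ≤ |(2 - n * δ x) - (2 - n * δ y)| := by
          simpa using abs_min_sub_min_le_max (2 - n * δ x) 1 (2 - n * δ y) 1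
      _ = n * |δ x - δ y| := by
          rw [show (2 - n * δ x) - (2 - n * δ y) = -(n * (δ x - δ y)) by ring, abs_neg, abs_mul,
            abs_of_pos hn]
      _ ≤ n * dist x y := by gcongr; exact hdist x y
  have hvzero : ∀ x, ¬ δ x ≤ 3 / n → v x = 0 := fun x hx => by
    rw [not_le, div_lt_iff₀ hn] at hx
    exact max_eq_right ((min_le_left _ _).trans (by linarith))
  have h2 : (1 : ℝ) ≤ 2 ^ (p - 1) := Real.one_le_rpow (by norm_num) (by linarith)
  -- one point in the neighbourhood, the other outside
  have hone : ∀ x y, δ x ≤ 3 / n → ¬ δ y ≤ 3 / n →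
      |f x * v x| ^ p ≤ 2 ^ (p - 1) * (|f x| ^ p * (min 1 (n * dist x y)) ^ p) := by
    intro x y hx hy
    have hbase : |f x * v x| ≤ |f x| * min 1 (n * dist x y) := by
      rw [abs_mul, abs_of_nonneg (hv0 x)]
      refine mul_le_mul_of_nonneg_left ?_ (abs_nonneg _)
      by_cases hx2 : 2 ≤ n * δ x
      · have : v x = 0 := max_eq_right ((min_le_left _ _).trans (by linarith))
        rw [this]; positivity
      · rw [not_le, div_lt_iff₀ hn] at hy
        have h3 := (le_abs_self _).trans ((abs_sub_comm (δ x) (δ y) ▸ hdist x y))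
        exact le_min (hv1 x) ((hv1 x).trans (by nlinarith))
    calc |f x * v x| ^ p ≤ (|f x| * min 1 (n * dist x y)) ^ p := by gcongr
      _ = |f x| ^ p * (min 1 (n * dist x y)) ^ p :=
          Real.mul_rpow (abs_nonneg _) (by positivity)
      _ ≤ _ := le_mul_of_one_le_left (by positivity) h2
  change |f x * v x - f y * v y| ^ p ≤ _
  by_cases hx : δ x ≤ 3 / n <;> by_cases hy : δ y ≤ 3 / n
  · simp only [indicator, mem_ofPred_eq, hx, hy, and_self, if_true]
    have hsplit : |f x * v x - f y * v y| ≤ |f x - f y| + |f x| * min 1 (n * dist x y) := by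
      calc |f x * v x - f y * v y| = |(f x - f y) * v y + f x * (v x - v y)| := by
            congr 1; ring
        _ ≤ |f x - f y| * v y + |f x| * |v x - v y| := by
            refine (abs_add_le _ _).trans_eq ?_
            rw [abs_mul, abs_mul, abs_of_nonneg (hv0 y)]
        _ ≤ |f x - f y| * 1 + |f x| * min 1 (n * dist x y) := by
            gcongr
            exact hv1 y
        _ = _ := by rw [mul_one]
    calc _ ≤ (|f x - f y| + |f x| * min 1 (n * dist x y)) ^ p := by gcongr
      _ ≤ _ := add_rpow_le_two_rpow_mul (abs_nonneg _) (by positivity) hp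
      _ ≤ _ := by
          rw [Real.mul_rpow (abs_nonneg _) (by positivity)]
          exact mul_le_mul_of_nonneg_left (le_add_of_nonneg_right (by positivity)) (by positivity)
  · simpa [indicator, hx, hy, hvzero y hy] using hone x y hx hy
  · simpa [indicator, hx, hy, hvzero x hx, dist_comm] using hone y x hy hx
  · simp [indicator, hx, hy, hvzero x hx, hvzero y hy, hp0.ne']

/-- Additivity of iterated integrals when the second summand is jointly measurable. -/
lemma lintegral_lintegral_add_right {X Y : Type*} [MeasurableSpace X] [MeasurableSpace Y]
    {μ : Measure X} {ν : Measure Y} [SFinite ν] {F G : X → Y → ℝ≥0∞}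
    (hG : Measurable (Function.uncurry G)) :
    ∫⁻ x, ∫⁻ y, F x y + G x y ∂ν ∂μ = (∫⁻ x, ∫⁻ y, F x y ∂ν ∂μ) + ∫⁻ x, ∫⁻ y, G x y ∂ν ∂μ := by
  have hx : ∀ x, ∫⁻ y, F x y + G x y ∂ν = ∫⁻ y, F x y ∂ν + ∫⁻ y, G x y ∂ν := fun x =>
    lintegral_add_right _ (hG.comp measurable_prodMk_left)
  simp_rw [hx]
  exact lintegral_add_right _ hG.lintegral_prod_right'

/-- One of the two diagonal terms of the cut-off estimate: a kernel bound with constant `M` turns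
a double integral into a single weighted integral over the strip. -/
lemma lintegral_indicator_mul_kernel_le {d : ℕ} {Ω S : Set (Rd d)} (hΩ : MeasurableSet Ω)
    (hS : MeasurableSet S) {δ g : Rd d → ℝ} (hδ : ∀ x ∈ Ω, 0 < δ x) (hg : ∀ x, 0 ≤ g x)
    {k : Rd d → Rd d → ℝ} {α β M : ℝ} (hM : 0 ≤ M)
    (hk : Measurable fun z : Rd d × Rd d => k z.1 z.2)
    (hker : ∀ x ∈ Ω, ∫⁻ y in Ω, ENNReal.ofReal (k x y) ≤ ENNReal.ofReal (M * δ x ^ (-β))) :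
    ∫⁻ x in Ω, ∫⁻ y in Ω,
        S.indicator (fun x => ENNReal.ofReal (g x * δ x ^ (-α))) x * ENNReal.ofReal (k x y) ≤
      ENNReal.ofReal M * ∫⁻ x in Ω ∩ S, ENNReal.ofReal (g x * δ x ^ (-(α + β))) := by
  calc _ ≤ ∫⁻ x in Ω, ENNReal.ofReal M *
        S.indicator (fun x => ENNReal.ofReal (g x * δ x ^ (-(α + β)))) x := by
        refine setLIntegral_mono' hΩ fun x hx => ?_
        have hkx : Measurable fun y => ENNReal.ofReal (k x y) :=
          (hk.comp measurable_prodMk_left).ennreal_ofReal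
        rw [lintegral_const_mul _ hkx]
        refine (mul_le_mul_right (hker x hx) _).trans ?_
        have hδx := hδ x hx
        have hgx := hg x
        by_cases hxS : x ∈ S
        · rw [indicator_of_mem hxS, indicator_of_mem hxS, ← ENNReal.ofReal_mul (by positivity),
            ← ENNReal.ofReal_mul hM, neg_add, Real.rpow_add hδx]
          exact (congrArg ENNReal.ofReal (by ring)).le
        · simp [indicator_of_notMem hxS]
    _ = _ := by
        rw [lintegral_const_mul' _ _ ENNReal.ofReal_ne_top, setLIntegral_indicator hS, inter_comm]

set_option maxHeartbeats 1000000 in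
/-- The cut-off estimate for measurable functions, given kernel bounds for both weights. -/
lemma gagP_cutoff_le_of_measurable {d : ℕ} {Ω : Set (Rd d)} (hΩ : MeasurableSet Ω)
    (hpos : ∀ x ∈ Ω, 0 < distBd Ω x) {s p α β n Cα Cβ : ℝ} (hp : 1 ≤ p) (hn : 0 < n)
    (hCα : 0 ≤ Cα) (hCβ : 0 ≤ Cβ)
    (hα : ∀ x ∈ Ω, ∫⁻ y in Ω, ENNReal.ofReal
        ((min 1 (n * dist x y)) ^ p / dist x y ^ ((d : ℝ) + s * p) * distBd Ω y ^ (-α))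
      ≤ ENNReal.ofReal (Cα * n ^ (s * p) * distBd Ω x ^ (-α)))
    (hβ : ∀ x ∈ Ω, ∫⁻ y in Ω, ENNReal.ofReal
        ((min 1 (n * dist x y)) ^ p / dist x y ^ ((d : ℝ) + s * p) * distBd Ω y ^ (-β))
      ≤ ENNReal.ofReal (Cβ * n ^ (s * p) * distBd Ω x ^ (-β)))
    {f : Rd d → ℝ} (hf : Measurable f) :
    gagP Ω s p α β (fun x => f x * max (min (2 - n * distBd Ω x) 1) 0) ≤
      ENNReal.ofReal (2 ^ (p - 1) * (Cα + Cβ) * n ^ (s * p)) *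
          (∫⁻ x in {x ∈ Ω | distBd Ω x ≤ 3 / n},
            ENNReal.ofReal (|f x| ^ p * distBd Ω x ^ (-(α + β))))
        + ENNReal.ofReal (2 ^ (p - 1)) *
          (∫⁻ x in {x ∈ Ω | distBd Ω x ≤ 3 / n},
            ∫⁻ y in {x ∈ Ω | distBd Ω x ≤ 3 / n}, ENNReal.ofReal
              (|f x - f y| ^ p / dist x y ^ ((d : ℝ) + s * p)
                * distBd Ω x ^ (-α) * distBd Ω y ^ (-β))) := by
  set δ : Rd d → ℝ := distBd Ω
  have hδL : LipschitzWith 1 δ := lipschitz_infDist_pt (frontier Ω)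
  have hδm : Measurable δ := hδL.continuous.measurable
  have hδ0 : ∀ x, 0 ≤ δ x := fun x => infDist_nonneg
  set S : Set (Rd d) := {x | δ x ≤ 3 / n} with hS
  have hSm : MeasurableSet S := measurableSet_le hδm measurable_const
  have hset : {x ∈ Ω | δ x ≤ 3 / n} = Ω ∩ S := rfl
  rw [hset]
  set k : ℝ → Rd d → Rd d → ℝ := fun γ x y =>
    (min 1 (n * dist x y)) ^ p / dist x y ^ ((d : ℝ) + s * p) * δ y ^ (-γ)
  have hkm : ∀ γ, Measurable fun z : Rd d × Rd d => k γ z.1 z.2 := fun γ => by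
    simp only [k]; fun_prop
  have hgm : ∀ γ : ℝ, Measurable (S.indicator fun x => ENNReal.ofReal (|f x| ^ p * δ x ^ (-γ))) :=
    fun γ => Measurable.indicator (by fun_prop) hSm
  set G : Rd d → Rd d → ℝ≥0∞ := fun x y => ENNReal.ofReal
    (|f x - f y| ^ p / dist x y ^ ((d : ℝ) + s * p) * δ x ^ (-α) * δ y ^ (-β))
  set T₁ : Rd d → Rd d → ℝ≥0∞ := fun x y => S.indicator (fun x => S.indicator (G x) y) x
  set T₂ : Rd d → Rd d → ℝ≥0∞ := fun x y =>
    S.indicator (fun x => ENNReal.ofReal (|f x| ^ p * δ x ^ (-α))) x * ENNReal.ofReal (k β x y)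
  set T₃ : Rd d → Rd d → ℝ≥0∞ := fun x y =>
    S.indicator (fun y => ENNReal.ofReal (|f y| ^ p * δ y ^ (-β))) y * ENNReal.ofReal (k α y x)
  have hT₂ : Measurable (Function.uncurry T₂) :=
    ((hgm α).comp measurable_fst).mul (hkm β).ennreal_ofReal
  have hT₃ : Measurable (Function.uncurry T₃) :=
    ((hgm β).comp measurable_snd).mul ((hkm α).comp measurable_swap).ennreal_ofReal
  have hpt : ∀ x y, ENNReal.ofReal
      (|f x * max (min (2 - n * δ x) 1) 0 - f y * max (min (2 - n * δ y) 1) 0| ^ p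
        / dist x y ^ ((d : ℝ) + s * p) * δ y ^ (-β) * δ x ^ (-α)) ≤
      ENNReal.ofReal (2 ^ (p - 1)) * (T₁ x y + T₂ x y + T₃ x y) := by
    intro x y
    have hx0 := hδ0 x
    have hy0 := hδ0 y
    set w := (dist x y ^ ((d : ℝ) + s * p))⁻¹ * δ y ^ (-β) * δ x ^ (-α) with hw
    have hw0 : 0 ≤ w := by positivity
    have h := mul_le_mul_of_nonneg_right (abs_cutoff_sub_rpow_le (f := f) hδL hp hn x y) hw0
    set I := {z : Rd d × Rd d | δ z.1 ≤ 3 / n ∧ δ z.2 ≤ 3 / n}.indicator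
      (fun z => |f z.1 - f z.2| ^ p) (x, y) with hI
    set a := {z | δ z ≤ 3 / n}.indicator (fun z => |f z| ^ p) x with ha
    set b := {z | δ z ≤ 3 / n}.indicator (fun z => |f z| ^ p) y with hb
    set m := (min 1 (n * dist x y)) ^ p with hm
    have hm0 : 0 ≤ m := by positivity
    have hI0 : 0 ≤ I := indicator_nonneg (fun z _ => by positivity) _
    have ha0 : 0 ≤ a := indicator_nonneg (fun z _ => by positivity) _
    have hb0 : 0 ≤ b := indicator_nonneg (fun z _ => by positivity) _
    have e₁ : ENNReal.ofReal (I * w) = T₁ x y := by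
      by_cases hx : x ∈ S <;> by_cases hy : y ∈ S
      · have : (x, y) ∈ {z : Rd d × Rd d | δ z.1 ≤ 3 / n ∧ δ z.2 ≤ 3 / n} := ⟨hx, hy⟩
        simp only [T₁, G, hI, indicator_of_mem, hx, hy, this, hw]
        congr 1; ring
      · have : (x, y) ∉ {z : Rd d × Rd d | δ z.1 ≤ 3 / n ∧ δ z.2 ≤ 3 / n} := fun h => hy h.2
        simp [T₁, hI, this, hy]
      · have : (x, y) ∉ {z : Rd d × Rd d | δ z.1 ≤ 3 / n ∧ δ z.2 ≤ 3 / n} := fun h => hx h.1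
        simp [T₁, hI, this, hx]
      · have : (x, y) ∉ {z : Rd d × Rd d | δ z.1 ≤ 3 / n ∧ δ z.2 ≤ 3 / n} := fun h => hx h.1
        simp [T₁, hI, this, hx]
    have e₂ : ENNReal.ofReal (a * m * w) = T₂ x y := by
      by_cases hx : x ∈ S
      · simp only [T₂, k, ha, ← hS, indicator_of_mem hx]
        rw [← ENNReal.ofReal_mul (by positivity)]
        congr 1; ring
      · simp [T₂, ha, ← hS, indicator_of_notMem hx]
    have e₃ : ENNReal.ofReal (b * m * w) = T₃ x y := by
      by_cases hy : y ∈ S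
      · simp only [T₃, k, hb, ← hS, indicator_of_mem hy]
        rw [← ENNReal.ofReal_mul (by positivity), dist_comm y x]
        congr 1; ring
      · simp [T₃, hb, ← hS, indicator_of_notMem hy]
    rw [← e₁, ← e₂, ← e₃, ← ENNReal.ofReal_add (by positivity) (by positivity),
      ← ENNReal.ofReal_add (by positivity) (by positivity), ← ENNReal.ofReal_mul (by positivity)]
    apply ENNReal.ofReal_le_ofReal
    refine le_trans (le_of_eq ?_) (h.trans_eq ?_) <;> simp only [hw] <;> ring
  have hI₁ : ∫⁻ x in Ω, ∫⁻ y in Ω, T₁ x y = ∫⁻ x in Ω ∩ S, ∫⁻ y in Ω ∩ S, G x y := by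
    have : ∀ x, ∫⁻ y in Ω, T₁ x y = S.indicator (fun x => ∫⁻ y in Ω ∩ S, G x y) x := by
      intro x
      by_cases hx : x ∈ S
      · simp only [T₁, indicator_of_mem hx]
        rw [setLIntegral_indicator hSm, inter_comm]
      · simp [T₁, indicator_of_notMem hx]
    simp_rw [this]
    rw [setLIntegral_indicator hSm, inter_comm]
  have hI₂ : ∫⁻ x in Ω, ∫⁻ y in Ω, T₂ x y ≤ ENNReal.ofReal (Cβ * n ^ (s * p)) *
      ∫⁻ x in Ω ∩ S, ENNReal.ofReal (|f x| ^ p * δ x ^ (-(α + β))) :=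
    lintegral_indicator_mul_kernel_le hΩ hSm hpos (fun x => by positivity) (by positivity)
      (hkm β) hβ
  have hI₃ : ∫⁻ x in Ω, ∫⁻ y in Ω, T₃ x y ≤ ENNReal.ofReal (Cα * n ^ (s * p)) *
      ∫⁻ x in Ω ∩ S, ENNReal.ofReal (|f x| ^ p * δ x ^ (-(α + β))) := by
    rw [lintegral_lintegral_swap hT₃.aemeasurable, add_comm α β]
    exact lintegral_indicator_mul_kernel_le hΩ hSm hpos (fun x => by positivity) (by positivity)
      (hkm α) hα
  calc _ ≤ ∫⁻ x in Ω, ∫⁻ y in Ω, ENNReal.ofReal (2 ^ (p - 1)) * (T₁ x y + T₂ x y + T₃ x y) :=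
        lintegral_mono fun x => lintegral_mono fun y => hpt x y
    _ = ENNReal.ofReal (2 ^ (p - 1)) * ((∫⁻ x in Ω, ∫⁻ y in Ω, T₁ x y) +
          (∫⁻ x in Ω, ∫⁻ y in Ω, T₂ x y) + ∫⁻ x in Ω, ∫⁻ y in Ω, T₃ x y) := by
        simp_rw [lintegral_const_mul' _ _ ENNReal.ofReal_ne_top]
        congr 1
        rw [lintegral_lintegral_add_right hT₃, lintegral_lintegral_add_right hT₂]
    _ ≤ ENNReal.ofReal (2 ^ (p - 1)) * ((∫⁻ x in Ω ∩ S, ∫⁻ y in Ω ∩ S, G x y) +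
          ENNReal.ofReal (Cβ * n ^ (s * p)) *
            (∫⁻ x in Ω ∩ S, ENNReal.ofReal (|f x| ^ p * δ x ^ (-(α + β)))) +
          ENNReal.ofReal (Cα * n ^ (s * p)) *
            ∫⁻ x in Ω ∩ S, ENNReal.ofReal (|f x| ^ p * δ x ^ (-(α + β)))) := by
        rw [hI₁]; gcongr
    _ = _ := by
        rw [show (2 : ℝ) ^ (p - 1) * (Cα + Cβ) * n ^ (s * p) =
          2 ^ (p - 1) * (Cβ * n ^ (s * p) + Cα * n ^ (s * p)) by ring,
          ENNReal.ofReal_mul (p := (2 : ℝ) ^ (p - 1)) (by positivity),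
          ENNReal.ofReal_add (by positivity) (by positivity)]
        ring

/-- the cut-off estimate for `f v_n` with
`v_n(x) = max(min(2 - n d_Ω(x), 1), 0)`, on a bounded uniform domain. -/
theorem stmt15 {d : ℕ} (Ω : Set (Rd d)) (hne : Ω.Nonempty)
    (hopen : IsOpen Ω) (hconn : IsConnected Ω) (hbdd : Bornology.IsBounded Ω)
    (hunif : IsUniformDomain Ω) (s p α β : ℝ)
    (hs0 : 0 < s) (hs1 : s < 1) (hp : 1 ≤ p)
    (hα0 : 0 ≤ α) (hα : α < lowerCodimA (frontier Ω))
    (hβ0 : 0 ≤ β) (hβ : β < lowerCodimA (frontier Ω)) :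
    ∃ C : ℝ, 0 < C ∧ ∀ f : Rd d → ℝ, memW Ω s p α β f → ∀ n : ℕ, 0 < n →
      gagP Ω s p α β (fun x => f x * max (min (2 - (n : ℝ) * distBd Ω x) 1) 0)
        ≤ ENNReal.ofReal (C * (n : ℝ) ^ (s * p)) *
            (∫⁻ x in {x ∈ Ω | distBd Ω x ≤ 3 / (n : ℝ)},
              ENNReal.ofReal (|f x| ^ p * distBd Ω x ^ (-(α + β))))
          + ENNReal.ofReal C *
            (∫⁻ x in {x ∈ Ω | distBd Ω x ≤ 3 / (n : ℝ)},
              ∫⁻ y in {x ∈ Ω | distBd Ω x ≤ 3 / (n : ℝ)}, ENNReal.ofReal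
                (|f x - f y| ^ p / dist x y ^ ((d : ℝ) + s * p)
                  * distBd Ω x ^ (-α) * distBd Ω y ^ (-β))) := by
  have hdiam : 0 < Metric.ediam (frontier Ω) := ediam_pos_of_lowerCodimA_pos (hα0.trans_lt hα)
  have hfne : (frontier Ω).Nonempty := by
    rw [nonempty_iff_ne_empty]
    intro h
    simp [h] at hdiam
  have hcomp : IsCompact (frontier Ω) :=
    hbdd.isCompact_closure.of_isClosed_subset isClosed_frontier frontier_subset_closure
  have hpos : ∀ x ∈ Ω, 0 < infDist x (frontier Ω) := fun x hx =>
    (isClosed_frontier.notMem_iff_infDist_pos hfne).1 fun h =>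
      disjoint_left.1 (disjoint_frontier_iff_isOpen.2 hopen) h hx
  have hqne : (lowerCodimSet (frontier Ω)).Nonempty := by
    rw [nonempty_iff_ne_empty]
    intro h
    rw [lowerCodimA, h, Real.sSup_empty] at hα
    linarith
  obtain ⟨q, hq, hqlt⟩ := exists_lt_of_lt_csSup hqne (max_lt hα hβ)
  obtain ⟨Cα, hCα, hkα⟩ := exists_setLIntegral_truncated_kernel_weight_le hopen.measurableSet hbdd
    hcomp hdiam hpos hq hs0 hs1 hp hα0 ((le_max_left _ _).trans_lt hqlt)
  obtain ⟨Cβ, hCβ, hkβ⟩ := exists_setLIntegral_truncated_kernel_weight_le hopen.measurableSet hbdd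
    hcomp hdiam hpos hq hs0 hs1 hp hβ0 ((le_max_right _ _).trans_lt hqlt)
  refine ⟨2 ^ (p - 1) * (Cα + Cβ) + 2 ^ (p - 1), by positivity, fun f hf n hn => ?_⟩
  have hn' : (0 : ℝ) < n := Nat.cast_pos.2 hn
  obtain ⟨g, hg, hfg⟩ := hf.1.aestronglyMeasurable.aemeasurable
  have hfgA : ∀ᵐ x ∂volume.restrict {x ∈ Ω | distBd Ω x ≤ 3 / (n : ℝ)}, f x = g x :=
    ae_restrict_of_ae_restrict_of_subset (sep_subset _ _) hfg
  have hL : gagP Ω s p α β (fun x => f x * max (min (2 - (n : ℝ) * distBd Ω x) 1) 0) =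
      gagP Ω s p α β (fun x => g x * max (min (2 - (n : ℝ) * distBd Ω x) 1) 0) := by
    refine lintegral_congr_ae (hfg.mono fun x hx => lintegral_congr_ae (hfg.mono fun y hy => ?_))
    simp only [hx, hy]
  have hR₁ : ∫⁻ x in {x ∈ Ω | distBd Ω x ≤ 3 / (n : ℝ)},
        ENNReal.ofReal (|f x| ^ p * distBd Ω x ^ (-(α + β))) =
      ∫⁻ x in {x ∈ Ω | distBd Ω x ≤ 3 / (n : ℝ)},
        ENNReal.ofReal (|g x| ^ p * distBd Ω x ^ (-(α + β))) :=
    lintegral_congr_ae (hfgA.mono fun x hx => by simp only [hx])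
  have hR₂ : ∫⁻ x in {x ∈ Ω | distBd Ω x ≤ 3 / (n : ℝ)},
        ∫⁻ y in {x ∈ Ω | distBd Ω x ≤ 3 / (n : ℝ)}, ENNReal.ofReal
          (|f x - f y| ^ p / dist x y ^ ((d : ℝ) + s * p)
            * distBd Ω x ^ (-α) * distBd Ω y ^ (-β)) =
      ∫⁻ x in {x ∈ Ω | distBd Ω x ≤ 3 / (n : ℝ)},
        ∫⁻ y in {x ∈ Ω | distBd Ω x ≤ 3 / (n : ℝ)}, ENNReal.ofReal
          (|g x - g y| ^ p / dist x y ^ ((d : ℝ) + s * p)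
            * distBd Ω x ^ (-α) * distBd Ω y ^ (-β)) :=
    lintegral_congr_ae (hfgA.mono fun x hx =>
      lintegral_congr_ae (hfgA.mono fun y hy => by simp only [hx, hy]))
  rw [hL, hR₁, hR₂]
  refine (gagP_cutoff_le_of_measurable hopen.measurableSet hpos hp hn' hCα.le hCβ.le
    (fun x hx => hkα x hx n hn') (fun x hx => hkβ x hx n hn') hg).trans ?_
  gcongr
  · exact le_add_of_nonneg_right (by positivity)
  · exact le_add_of_nonneg_left (by positivity)
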